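/- arXiv:2208.11239 — 2 statements merged into one kernel-verified Lean document; each statement's English description precedes it below -/
import Mathlib

section
/- Let X be a finite-dimensional real Banach space of dimension at least 2 and let t ∈ [0, 1]. Then S_P(X) ≥ (γ_X(t) + t² − 3)/(2 + 2t²). -/
/-- The P-angle constant `S_P(X)`. -/
noncomputable def SP (X : Type*) [NormedAddCommGroup X] [NormedSpace ℝ X] : ℝ :=
  sSup {r : ℝ | ∃ x y : X, ‖x‖ = 1 ∧ ‖y‖ = 1 ∧ x ≠ y ∧ x ≠ -y ∧
    r = (‖x + y‖ ^ 2 + ‖x - y‖ ^ 2 - 4) / (2 * ‖x + y‖ * ‖x - y‖)}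

/-- The function `γ_X(t)`. -/
noncomputable def gammaX (X : Type*) [NormedAddCommGroup X] [NormedSpace ℝ X] (t : ℝ) : ℝ :=
  sSup {r : ℝ | ∃ x y : X, ‖x‖ = 1 ∧ ‖y‖ = 1 ∧
    r = (‖x + t • y‖ ^ 2 + ‖x - t • y‖ ^ 2) / 2}

/-- The set whose supremum is `S_P(X)` is bounded above by `1`. -/
theorem bddAbove_SP (X : Type*) [NormedAddCommGroup X] [NormedSpace ℝ X] :
    BddAbove {r : ℝ | ∃ x y : X, ‖x‖ = 1 ∧ ‖y‖ = 1 ∧ x ≠ y ∧ x ≠ -y ∧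
      r = (‖x + y‖ ^ 2 + ‖x - y‖ ^ 2 - 4) / (2 * ‖x + y‖ * ‖x - y‖)} := by
  refine ⟨1, ?_⟩
  rintro r ⟨x, y, hx, hy, hxy, hxy', rfl⟩
  have ha : 0 < ‖x + y‖ := norm_pos_iff.2 fun h => hxy' (eq_neg_of_add_eq_zero_left h)
  have hb : 0 < ‖x - y‖ := norm_pos_iff.2 (sub_ne_zero.2 hxy)
  have ha2 := norm_add_le x y
  have hb2 := norm_sub_le x y
  rw [div_le_one (by positivity)]
  nlinarith

/-- The defining inequality of `S_P(X)`, cleared of denominators; it also holds for `x = ± y`. -/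
theorem sq_add_sq_le_SP {X : Type*} [NormedAddCommGroup X] [NormedSpace ℝ X] {x y : X}
    (hx : ‖x‖ = 1) (hy : ‖y‖ = 1) :
    ‖x + y‖ ^ 2 + ‖x - y‖ ^ 2 ≤ 4 + 2 * (‖x + y‖ * ‖x - y‖) * SP X := by
  have ha2 := norm_add_le x y
  have hb2 := norm_sub_le x y
  rcases eq_or_ne x y with rfl | hxy
  · simp only [sub_self, norm_zero]
    nlinarith [norm_nonneg (x + x)]
  rcases eq_or_ne x (-y) with rfl | hxy'
  · simp only [neg_add_cancel, norm_zero]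
    nlinarith [norm_nonneg (-y - y)]
  have ha : 0 < ‖x + y‖ := norm_pos_iff.2 fun h => hxy' (eq_neg_of_add_eq_zero_left h)
  have hb : 0 < ‖x - y‖ := norm_pos_iff.2 (sub_ne_zero.2 hxy)
  have h : (‖x + y‖ ^ 2 + ‖x - y‖ ^ 2 - 4) / (2 * ‖x + y‖ * ‖x - y‖) ≤ SP X :=
    le_csSup (bddAbove_SP X) ⟨x, y, hx, hy, hxy, hxy', rfl⟩
  rw [div_le_iff₀ (by positivity)] at h
  linarith

/-- In dimension at least `2` there are isosceles orthogonal unit vectors. -/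
theorem exists_norm_add_eq_norm_sub (X : Type*) [NormedAddCommGroup X] [NormedSpace ℝ X]
    (hdim : 2 ≤ Module.rank ℝ X) :
    ∃ x y : X, ‖x‖ = 1 ∧ ‖y‖ = 1 ∧ ‖x + y‖ = ‖x - y‖ := by
  have hrank : 1 < Module.rank ℝ X := lt_of_lt_of_le (by norm_num) hdim
  have hconn := isConnected_sphere hrank (0 : X) zero_le_one
  obtain ⟨x, hx⟩ := hconn.nonempty
  have hx' : -x ∈ Metric.sphere (0 : X) 1 := by simpa using hx
  obtain ⟨y, hy, hxy⟩ := hconn.isPreconnected.intermediate_value₂ hx' hx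
    (f := fun y => ‖x + y‖) (g := fun y => ‖x - y‖)
    (by fun_prop) (by fun_prop) (by simp) (by simp)
  exact ⟨x, y, by simpa using hx, by simpa using hy, hxy⟩

theorem SP_nonneg (X : Type*) [NormedAddCommGroup X] [NormedSpace ℝ X]
    (hdim : 2 ≤ Module.rank ℝ X) : 0 ≤ SP X := by
  obtain ⟨x, y, hx, hy, hxy⟩ := exists_norm_add_eq_norm_sub X hdim
  set a := ‖x + y‖ with ha
  have hsum : (x + y) + (x - y) = (2 : ℝ) • x := by rw [two_smul]; abel
  have hdiff : (x + y) - (x - y) = (2 : ℝ) • y := by rw [two_smul]; abel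
  have ha0 : 0 < a := by
    have h := norm_add_le (x + y) (x - y)
    rw [hsum, norm_smul, hx, ← hxy, ← ha] at h
    norm_num at h
    linarith
  have h₁ := sq_add_sq_le_SP hx hy
  rw [← hxy, ← ha] at h₁
  have h₂ := sq_add_sq_le_SP (x := a⁻¹ • (x + y)) (y := a⁻¹ • (x - y))
    (by rw [norm_smul, ← ha, Real.norm_of_nonneg (by positivity)]; field_simp)
    (by rw [norm_smul, ← hxy, Real.norm_of_nonneg (by positivity)]; field_simp)
  rw [← smul_add, ← smul_sub, hsum, hdiff, norm_smul, norm_smul, norm_smul, norm_smul, hx, hy,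
    Real.norm_of_nonneg (by positivity : (0 : ℝ) ≤ a⁻¹)] at h₂
  norm_num at h₂
  by_contra! hneg
  have hsq : a ^ 2 < 2 := by nlinarith [mul_pos ha0 ha0]
  have hinv : 0 < a⁻¹ := inv_pos.2 ha0
  have hsq' : 2 * a⁻¹ ^ 2 < 1 := by nlinarith [mul_pos hinv hinv]
  have hone : a ^ 2 * a⁻¹ ^ 2 = 1 := by field_simp
  nlinarith [mul_pos hinv hinv]

/-- The bound on `‖x + ty‖` coming from writing `x + ty` as a convex combination. -/
theorem norm_add_smul_le {X : Type*} [NormedAddCommGroup X] [NormedSpace ℝ X] (x y : X)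
    {t : ℝ} (ht : t ∈ Set.Icc (-1 : ℝ) 1) :
    ‖x + t • y‖ ≤ (1 + t) / 2 * ‖x + y‖ + (1 - t) / 2 * ‖x - y‖ := by
  have h : x + t • y = ((1 + t) / 2) • (x + y) + ((1 - t) / 2) • (x - y) := by module
  rw [h]
  refine (norm_add_le _ _).trans_eq ?_
  rw [norm_smul, norm_smul, Real.norm_of_nonneg (by linarith [ht.1]),
    Real.norm_of_nonneg (by linarith [ht.2])]

theorem stmt_8 (X : Type*) [NormedAddCommGroup X] [NormedSpace ℝ X]
    [FiniteDimensional ℝ X] (hdim : 2 ≤ Module.rank ℝ X)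
    (t : ℝ) (ht : t ∈ Set.Icc (0 : ℝ) 1) :
    SP X ≥ (gammaX X t + t ^ 2 - 3) / (2 + 2 * t ^ 2) := by
  obtain ⟨ht0, ht1⟩ := ht
  have hS := SP_nonneg X hdim
  suffices h : gammaX X t ≤ SP X * (2 + 2 * t ^ 2) + 3 - t ^ 2 by
    rw [ge_iff_le, div_le_iff₀ (by positivity)]
    linarith
  obtain ⟨x₀, y₀, hx₀, hy₀, -⟩ := exists_norm_add_eq_norm_sub X hdim
  refine csSup_le ⟨_, x₀, y₀, hx₀, hy₀, rfl⟩ ?_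
  rintro r ⟨x, y, hx, hy, rfl⟩
  have hA := norm_add_smul_le x y (t := t) ⟨by linarith, ht1⟩
  have hB := norm_add_smul_le x y (t := -t) ⟨by linarith, by linarith⟩
  rw [neg_smul, ← sub_eq_add_neg, sub_neg_eq_add, ← sub_eq_add_neg] at hB
  have hkey := sq_add_sq_le_SP hx hy
  have ha : ‖x + y‖ ≤ 2 := (norm_add_le x y).trans (by linarith)
  have hb : ‖x - y‖ ≤ 2 := (norm_sub_le x y).trans (by linarith)
  have hA2 := pow_le_pow_left₀ (norm_nonneg _) hA 2
  have hB2 := pow_le_pow_left₀ (norm_nonneg _) hB 2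
  have hp : ‖x + y‖ * ‖x - y‖ ≤ 4 := by
    nlinarith [norm_nonneg (x + y), norm_nonneg (x - y)]
  have ht2 : 0 ≤ 1 - t ^ 2 := by nlinarith
  have h₁ := mul_le_mul_of_nonneg_left hkey (by positivity : 0 ≤ 1 + t ^ 2)
  have h₂ := mul_le_mul_of_nonneg_left hp ht2
  have h₃ := mul_le_mul_of_nonneg_left hp (mul_nonneg (by positivity : 0 ≤ 1 + t ^ 2) hS)
  linarith
end

section
/- Let X be a real Banach space of dimension at least 2. If S_P(X) < 1/2, then J(X) < 2. -/
/-- The James constant `J(X)`. -/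
noncomputable def JamesConst (X : Type*) [NormedAddCommGroup X] [NormedSpace ℝ X] : ℝ :=
  sSup {r : ℝ | ∃ x y : X, ‖x‖ = 1 ∧ ‖y‖ = 1 ∧ r = min ‖x + y‖ ‖x - y‖}

theorem norm_add_le_two {E : Type*} [SeminormedAddCommGroup E] {x y : E}
    (hx : ‖x‖ = 1) (hy : ‖y‖ = 1) : ‖x + y‖ ≤ 2 := by
  linarith [norm_add_le x y]

theorem norm_sub_le_two {E : Type*} [SeminormedAddCommGroup E] {x y : E}
    (hx : ‖x‖ = 1) (hy : ‖y‖ = 1) : ‖x - y‖ ≤ 2 := by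
  linarith [norm_sub_le x y]

theorem div_two_mul_mul_le_half {a b : ℝ} (ha : 0 < a) (hb : 0 < b) (ha2 : a ≤ 2) (hb2 : b ≤ 2) :
    (a ^ 2 + b ^ 2 - 4) / (2 * a * b) ≤ 1 / 2 := by
  rw [div_le_iff₀ (by positivity)]
  rcases le_total a b with hab | hab <;> nlinarith

section UnitSphere

variable {X : Type*} [NormedAddCommGroup X] [NormedSpace ℝ X]

/-- On the unit sphere, the quotient defining `SP X` is bounded above by `SP X`. -/
theorem le_SP {x y : X} (hx : ‖x‖ = 1) (hy : ‖y‖ = 1) (hne : x ≠ y) (hne' : x ≠ -y) :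
    (‖x + y‖ ^ 2 + ‖x - y‖ ^ 2 - 4) / (2 * ‖x + y‖ * ‖x - y‖) ≤ SP X := by
  refine le_csSup ⟨1 / 2, ?_⟩ ⟨x, y, hx, hy, hne, hne', rfl⟩
  rintro _ ⟨u, v, hu, hv, huv, huv', rfl⟩
  exact div_two_mul_mul_le_half (norm_pos_iff.2 fun h => huv' (eq_neg_of_add_eq_zero_left h))
    (norm_pos_iff.2 (sub_ne_zero.2 huv)) (norm_add_le_two hu hv) (norm_sub_le_two hu hv)

theorem min_norm_le_sqrt {x y : X} (hx : ‖x‖ = 1) (hy : ‖y‖ = 1) :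
    min ‖x + y‖ ‖x - y‖ ≤ √(2 + 4 * max (SP X) 0) := by
  by_cases hne : x = y
  · simp [hne]
  by_cases hne' : x = -y
  · simp [hne']
  have ha : 0 < ‖x + y‖ := norm_pos_iff.2 fun h => hne' (eq_neg_of_add_eq_zero_left h)
  have hb : 0 < ‖x - y‖ := norm_pos_iff.2 (sub_ne_zero.2 hne)
  have hr := (le_SP hx hy hne hne').trans (le_max_left _ 0)
  rw [div_le_iff₀ (by positivity)] at hr
  have hab : ‖x + y‖ * ‖x - y‖ ≤ 2 * 2 :=
    mul_le_mul (norm_add_le_two hx hy) (norm_sub_le_two hx hy) hb.le zero_le_two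
  have hprod := mul_le_mul_of_nonneg_left hab (le_max_right (SP X) 0)
  have hmin : 0 ≤ min ‖x + y‖ ‖x - y‖ := le_min ha.le hb.le
  have hmin_add := pow_le_pow_left₀ hmin (min_le_left ‖x + y‖ ‖x - y‖) 2
  have hmin_sub := pow_le_pow_left₀ hmin (min_le_right ‖x + y‖ ‖x - y‖) 2
  apply Real.le_sqrt_of_sq_le
  linarith

theorem JamesConst_le_sqrt (X : Type*) [NormedAddCommGroup X] [NormedSpace ℝ X] :
    JamesConst X ≤ √(2 + 4 * max (SP X) 0) := by
  refine Real.sSup_le ?_ (Real.sqrt_nonneg _)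
  rintro _ ⟨x, y, hx, hy, rfl⟩
  exact min_norm_le_sqrt hx hy

end UnitSphere

theorem stmt_11 (X : Type*) [NormedAddCommGroup X] [NormedSpace ℝ X] [CompleteSpace X]
    (hdim : 2 ≤ Module.rank ℝ X) (h : SP X < 1 / 2) :
    JamesConst X < 2 := by
  refine (JamesConst_le_sqrt X).trans_lt ?_
  rw [Real.sqrt_lt' two_pos]
  have hmax : max (SP X) 0 < 1 / 2 := max_lt h (by norm_num)
  linarith
end
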